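/- arXiv:2605.14093 — 9 statements merged into one kernel-verified Lean document; each statement's English description precedes it below -/
import Mathlib

section
/- Variable branching preserves parity: let φ be a CNF formula over a finite variable set V, let x ∈ V, and suppose the clauses of φ containing a literal of x are exactly d distinct clauses (ℓ_1 ∨ C_1), …, (ℓ_d ∨ C_d), where each ℓ_i ∈ {x, ¬x} is a literal of x and each C_i is a clause not containing any literal of x. For each i ∈ {1, …, d}, let N_i be the number of assignments σ : V → Bool that satisfy every clause of φ, satisfy each of the clauses C_1, …, C_{i−1}, falsify C_i, and make the literal ℓ_i true. Then #sat(φ) ≡ N_1 + N_2 + ⋯ + N_d (mod 2). -/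
/-- An assignment `σ` satisfies a clause (a finite set of literals, where a literal is a
variable together with a polarity) if it makes at least one literal true. -/
def SatClause {V : Type*} (σ : V → Bool) (C : Finset (V × Bool)) : Prop :=
  ∃ ℓ ∈ C, σ ℓ.1 = ℓ.2

/-- An assignment `σ` falsifies a clause if it makes every literal of the clause false. -/
def FalsClause {V : Type*} (σ : V → Bool) (C : Finset (V × Bool)) : Prop :=
  ∀ ℓ ∈ C, σ ℓ.1 ≠ ℓ.2

/-- An assignment `σ` satisfies a CNF formula if it satisfies every clause. -/
def SatFormula {V : Type*} (σ : V → Bool) (φ : Finset (Finset (V × Bool))) : Prop :=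
  ∀ C ∈ φ, SatClause σ C

/-- `numSat V φ` is the number of assignments `σ : V → Bool` satisfying the formula `φ`. -/
noncomputable def numSat (V : Type*) (φ : Finset (Finset (V × Bool))) : ℕ :=
  Nat.card {σ : V → Bool // SatFormula σ φ}

/-- An assignment falsifies a clause exactly when it does not satisfy it. -/
theorem falsClause_iff_not_satClause {V : Type*} (σ : V → Bool) (C : Finset (V × Bool)) :
    FalsClause σ C ↔ ¬ SatClause σ C := by
  simp only [FalsClause, SatClause, not_exists, not_and, ne_eq]

/-- Changing the value of a variable that does not occur in a clause preserves satisfaction. -/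
theorem SatClause.update {V : Type*} [DecidableEq V] {σ : V → Bool} {C : Finset (V × Bool)}
    {x : V} (h : SatClause σ C) (hx : ∀ b : Bool, (x, b) ∉ C) (c : Bool) :
    SatClause (Function.update σ x c) C := by
  obtain ⟨⟨y, b⟩, hl, hs⟩ := h
  have hy : y ≠ x := fun hyx => hx b (hyx ▸ hl)
  exact ⟨(y, b), hl, by simpa [hy] using hs⟩

/-- Satisfaction of a clause is monotone in the clause. -/
theorem SatClause.mono {V : Type*} {σ : V → Bool} {C D : Finset (V × Bool)}
    (h : SatClause σ C) (hCD : C ⊆ D) : SatClause σ D := by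
  obtain ⟨l, hl, hs⟩ := h
  exact ⟨l, hCD hl, hs⟩

/-- A finite set of assignments closed under flipping a variable has even cardinality. -/
theorem even_card_of_flip_mem {V : Type*} [DecidableEq V] (x : V) (A : Finset (V → Bool))
    (hA : ∀ σ ∈ A, Function.update σ x (!σ x) ∈ A) : Even A.card := by
  have h : ∑ _σ ∈ A, (1 : ZMod 2) = 0 := by
    refine Finset.sum_involution (fun σ _ => Function.update σ x (!σ x)) ?_ ?_ hA ?_
    · intro σ _
      decide
    · intro σ _ _ h
      simpa using congrFun h x
    · intro σ _
      simp
  rw [← ZMod.natCast_eq_zero_iff_even]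
  simpa using h

/-- A finite set splits into the elements satisfying all of the predicates `P 0, …, P (d - 1)`
and the elements for which `P i` is the first predicate to fail. -/
theorem card_eq_card_filter_forall_add_sum {α : Type*} {d : ℕ} (S : Finset α)
    (P : Fin d → α → Prop) [∀ i, DecidablePred (P i)] :
    S.card = (S.filter fun a => ∀ i, P i a).card +
      ∑ i, (S.filter fun a => (∀ j, j < i → P j a) ∧ ¬ P i a).card := by
  classical
  rw [← Finset.card_filter_add_card_filter_not (s := S) (fun a => ∀ i, P i a),
    ← Finset.card_biUnion]
  · congr 2
    ext a
    simp only [Finset.mem_filter, Finset.mem_biUnion, Finset.mem_univ, true_and]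
    constructor
    · rintro ⟨ha, hP⟩
      obtain ⟨i, hi, hmin⟩ := WellFounded.has_min (wellFounded_lt (α := Fin d))
        {i | ¬ P i a} (not_forall.mp hP)
      exact ⟨i, ha, fun j hj => by_contra fun hPj => hmin j hPj hj, hi⟩
    · rintro ⟨i, ha, -, hi⟩
      exact ⟨ha, fun h => hi (h i)⟩
  · intro i _ j _ hij
    rw [Function.onFun, Finset.disjoint_left]
    intro a hai haj
    simp only [Finset.mem_filter] at hai haj
    rcases lt_or_gt_of_ne hij with h | h
    · exact hai.2.2 (haj.2.1 i h)
    · exact haj.2.2 (hai.2.1 j h)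

/-- Variable branching preserves parity: if the clauses of `φ` containing a literal of `x`
are exactly the `d` distinct clauses `(ℓ_1 ∨ C_1), …, (ℓ_d ∨ C_d)`, where each `ℓ_i` is a
literal of `x` and no `C_i` contains a literal of `x`, then
`#sat(φ) ≡ N_1 + ⋯ + N_d (mod 2)`, where `N_i` counts the assignments satisfying every
clause of `φ`, satisfying `C_1, …, C_{i−1}`, falsifying `C_i`, and making `ℓ_i` true. -/
theorem variable_branching_parity (V : Type*) [Fintype V] [DecidableEq V]
    (φ : Finset (Finset (V × Bool))) (x : V) (d : ℕ)
    (ℓ : Fin d → V × Bool) (C : Fin d → Finset (V × Bool))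
    (hvar : ∀ i, (ℓ i).1 = x)
    (hCx : ∀ i, ∀ b : Bool, (x, b) ∉ C i)
    (hdistinct : Function.Injective (fun i : Fin d => insert (ℓ i) (C i)))
    (hclauses : φ.filter (fun D => (x, true) ∈ D ∨ (x, false) ∈ D) =
      Finset.image (fun i : Fin d => insert (ℓ i) (C i)) Finset.univ) :
    numSat V φ ≡
      ∑ i : Fin d,
        Nat.card {σ : V → Bool // SatFormula σ φ ∧
          (∀ j : Fin d, j < i → SatClause σ (C j)) ∧
          FalsClause σ (C i) ∧ σ x = (ℓ i).2} [MOD 2] := by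
  classical
  have hmem : ∀ i, insert (ℓ i) (C i) ∈ φ := fun i =>
    (Finset.mem_filter.mp (hclauses ▸ Finset.mem_image_of_mem _ (Finset.mem_univ i))).1
  set S : Finset (V → Bool) := Finset.univ.filter fun σ => SatFormula σ φ with hS
  have hN : ∀ i, Nat.card {σ : V → Bool // SatFormula σ φ ∧
      (∀ j : Fin d, j < i → SatClause σ (C j)) ∧ FalsClause σ (C i) ∧ σ x = (ℓ i).2} =
      (S.filter fun σ => (∀ j, j < i → SatClause σ (C j)) ∧ ¬ SatClause σ (C i)).card := by
    intro i
    rw [Nat.card_eq_fintype_card, Fintype.card_subtype, hS, Finset.filter_filter]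
    congr 1
    refine Finset.filter_congr fun σ _ => ?_
    rw [falsClause_iff_not_satClause]
    refine and_congr_right fun hσ => and_congr_right fun _ => and_iff_left_of_imp fun hi => ?_
    obtain ⟨l, hl, hs⟩ := hσ _ (hmem i)
    rcases Finset.mem_insert.mp hl with rfl | hl
    · rwa [hvar i] at hs
    · exact absurd ⟨l, hl, hs⟩ hi
  have heven : Even (S.filter fun σ => ∀ i, SatClause σ (C i)).card := by
    refine even_card_of_flip_mem x _ fun σ hσ => ?_
    simp only [hS, Finset.mem_filter, Finset.mem_univ, true_and] at hσ ⊢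
    have hC := fun i => (hσ.2 i).update (hCx i) (!σ x)
    refine ⟨fun D hD => ?_, hC⟩
    by_cases hx : (x, true) ∈ D ∨ (x, false) ∈ D
    · obtain ⟨i, -, rfl⟩ := Finset.mem_image.mp (hclauses ▸ Finset.mem_filter.mpr ⟨hD, hx⟩)
      exact (hC i).mono (Finset.subset_insert _ _)
    · rw [not_or] at hx
      exact (hσ.1 D hD).update (Bool.forall_bool.mpr ⟨hx.2, hx.1⟩) _
  have hcard : numSat V φ = S.card := by
    rw [numSat, Nat.card_eq_fintype_card, Fintype.card_subtype]
  rw [hcard, card_eq_card_filter_forall_add_sum S fun i σ => SatClause σ (C i),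
    Finset.sum_congr rfl fun i _ => hN i]
  exact Nat.add_modEq_right_iff.mpr heven.two_dvd
end

section
/- Correctness of the domination rule: let φ be a CNF formula over a finite variable set V, let ℓ be a literal of a variable u ∈ V, and let y ∈ V with y ≠ u be a variable such that every clause of φ containing a literal of y also contains the literal ℓ. Then the number of assignments σ : V → Bool that satisfy φ and make ℓ true is even; consequently #sat(φ) ≡ (number of assignments satisfying φ that make ℓ false) (mod 2). -/
/-- A finite type with a fixed-point-free involution has even cardinality. -/
theorem even_natCard_of_involutive {α : Type*} [Finite α] {f : α → α}
    (hf : Function.Involutive f) (hne : ∀ a, f a ≠ a) : Even (Nat.card α) := by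
  have := Fintype.ofFinite α
  rw [Nat.card_eq_fintype_card, ← ZMod.natCast_eq_zero_iff_even]
  have h : ∑ _a : α, (1 : ZMod 2) = 0 :=
    Finset.sum_involution (fun a _ => f a) (fun _ _ => by decide) (fun a _ _ => hne a)
      (fun _ _ => Finset.mem_univ _) (fun a _ => hf a)
  simpa using h

/-- Changing the value of a variable `y` preserves satisfaction, provided that every clause
mentioning `y` contains a true literal `ℓ` of another variable. -/
theorem SatFormula.update {V : Type*} [DecidableEq V] {φ : Finset (Finset (V × Bool))}
    {ℓ : V × Bool} {y : V} {σ : V → Bool} (hy : y ≠ ℓ.1)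
    (hdom : ∀ C ∈ φ, ((y, true) ∈ C ∨ (y, false) ∈ C) → ℓ ∈ C)
    (hσ : SatFormula σ φ) (hℓ : σ ℓ.1 = ℓ.2) (b : Bool) :
    SatFormula (Function.update σ y b) φ := by
  intro C hC
  obtain ⟨⟨v, c⟩, hm, hm_true⟩ := hσ C hC
  by_cases hv : v = y
  · subst hv
    refine ⟨ℓ, hdom C hC ?_, by rwa [Function.update_of_ne hy.symm]⟩
    cases c
    · exact Or.inr hm
    · exact Or.inl hm
  · exact ⟨(v, c), hm, by rwa [Function.update_of_ne hv]⟩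

/-- Correctness of the domination rule: if `ℓ` is a literal of a variable `u = ℓ.1`, `y ≠ u`
is a variable, and every clause of `φ` containing a literal of `y` also contains `ℓ`, then
the number of satisfying assignments making `ℓ` true is even, and consequently
`#sat(φ)` is congruent mod 2 to the number of satisfying assignments making `ℓ` false. -/
theorem domination_rule (V : Type*) [Fintype V]
    (φ : Finset (Finset (V × Bool))) (ℓ : V × Bool) (y : V)
    (hy : y ≠ ℓ.1)
    (hdom : ∀ C ∈ φ, ((y, true) ∈ C ∨ (y, false) ∈ C) → ℓ ∈ C) :
    Even (Nat.card {σ : V → Bool // SatFormula σ φ ∧ σ ℓ.1 = ℓ.2}) ∧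
    numSat V φ ≡ Nat.card {σ : V → Bool // SatFormula σ φ ∧ σ ℓ.1 ≠ ℓ.2} [MOD 2] := by
  classical
  have heven : Even (Nat.card {σ : V → Bool // SatFormula σ φ ∧ σ ℓ.1 = ℓ.2}) := by
    let flip : {σ : V → Bool // SatFormula σ φ ∧ σ ℓ.1 = ℓ.2} →
        {σ : V → Bool // SatFormula σ φ ∧ σ ℓ.1 = ℓ.2} := fun σ =>
      ⟨Function.update σ.1 y (!σ.1 y), σ.2.1.update hy hdom σ.2.2 _, by
        rw [Function.update_of_ne hy.symm]; exact σ.2.2⟩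
    refine even_natCard_of_involutive (f := flip) (fun σ => Subtype.ext ?_) (fun σ h => ?_)
    · simp [flip]
    · simpa [flip] using congrFun (congrArg Subtype.val h) y
  refine ⟨heven, ?_⟩
  have hsplit : numSat V φ = Nat.card {σ : V → Bool // SatFormula σ φ ∧ σ ℓ.1 = ℓ.2} +
      Nat.card {σ : V → Bool // SatFormula σ φ ∧ σ ℓ.1 ≠ ℓ.2} := by
    simp only [numSat, Nat.card_eq_fintype_card, Fintype.card_subtype, ← Finset.filter_filter]
    exact (Finset.card_filter_add_card_filter_not _).symm
  rw [hsplit, Nat.ModEq, Nat.add_mod, Nat.even_iff.mp heven, zero_add, Nat.mod_mod]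
end

section
/- Correctness of the twins rule: let φ be a CNF formula over a finite variable set V, and let ℓ_a and ℓ_b be literals of distinct variables a and b of V that are twins in φ, i.e., for every clause C ∈ φ, C contains ℓ_a if and only if C contains ℓ_b, and C contains ¬ℓ_a if and only if C contains ¬ℓ_b. Let φ' be the CNF formula over V \ {b} obtained from φ by deleting the literals ℓ_b and ¬ℓ_b from every clause. Then #sat(φ) ≡ #sat(φ') (mod 2), where #sat(φ') counts assignments of V \ {b}. -/
/-- The clause over `V \ {b}` obtained from the clause `C` by deleting all literals of the
variable `b`: its literals are exactly the literals of `C` whose variable is not `b`. -/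
def delVar {V : Type*} [Fintype V] [DecidableEq V] (b : V) (C : Finset (V × Bool)) :
    Finset ({v : V // v ≠ b} × Bool) :=
  Finset.univ.filter (fun ℓ' => ((ℓ'.1 : V), ℓ'.2) ∈ C)

/-- Exchange the values of `a` and `b`, flipping both of them when `c` is true. -/
def swapXor {V : Type*} [DecidableEq V] (a b : V) (c : Bool) (σ : V → Bool) : V → Bool :=
  fun v => if v = a then σ b ^^ c else if v = b then σ a ^^ c else σ v

/-- Extend an assignment of `V \ {b}` by giving `b` the value of `a`, flipped when `c` is true. -/
def extendXor {V : Type*} [DecidableEq V] {a b : V} (hab : a ≠ b) (c : Bool)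
    (τ : {v : V // v ≠ b} → Bool) : V → Bool :=
  fun v => if h : v = b then τ ⟨a, hab⟩ ^^ c else τ ⟨v, h⟩

theorem swapXor_involutive {V : Type*} [DecidableEq V] {a b : V} (hab : a ≠ b) (c : Bool) :
    Function.Involutive (swapXor a b c) := by
  intro σ
  funext v
  by_cases hva : v = a
  · subst hva
    simp [swapXor, hab.symm]
  · by_cases hvb : v = b
    · subst hvb
      simp [swapXor, hva]
    · simp [swapXor, hva, hvb]

theorem swapXor_eq_self_iff {V : Type*} [DecidableEq V] {a b : V} (c : Bool) (σ : V → Bool) :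
    swapXor a b c σ = σ ↔ σ b = (σ a ^^ c) := by
  constructor
  · intro h
    have := congrFun h a
    simp only [swapXor, if_true] at this
    simp [← this]
  · intro h
    funext v
    simp only [swapXor]
    split_ifs with hva hvb
    · simp [hva, h]
    · simp [hvb, h]
    · rfl

theorem SatFormula.swapXor {V : Type*} [DecidableEq V] {φ : Finset (Finset (V × Bool))}
    {a b : V} {c : Bool} (hab : a ≠ b)
    (htwin : ∀ C ∈ φ, ∀ p, (a, p) ∈ C ↔ (b, p ^^ c) ∈ C) {σ : V → Bool}
    (hσ : SatFormula σ φ) : SatFormula (swapXor a b c σ) φ := by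
  intro C hC
  obtain ⟨⟨v, p⟩, hℓ, hp⟩ := hσ C hC
  obtain rfl : σ v = p := hp
  by_cases hva : v = a
  · subst hva
    exact ⟨_, (htwin C hC _).1 hℓ, by simp [_root_.swapXor, hab.symm]⟩
  · by_cases hvb : v = b
    · subst hvb
      exact ⟨(a, σ v ^^ c), (htwin C hC _).2 (by simpa using hℓ), by simp [_root_.swapXor]⟩
    · exact ⟨_, hℓ, by simp [_root_.swapXor, hva, hvb]⟩

theorem satFormula_image_delVar_iff {V : Type*} [Fintype V] [DecidableEq V]
    {φ : Finset (Finset (V × Bool))} {a b : V} {c : Bool} (hab : a ≠ b)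
    (htwin : ∀ C ∈ φ, ∀ p, (a, p) ∈ C ↔ (b, p ^^ c) ∈ C) {σ : V → Bool}
    (hσ : σ b = (σ a ^^ c)) :
    SatFormula (fun v : {v : V // v ≠ b} => σ v) (φ.image (delVar b)) ↔ SatFormula σ φ := by
  simp only [SatFormula, Finset.forall_mem_image]
  refine forall₂_congr fun C hC => ?_
  constructor
  · rintro ⟨ℓ, hℓ, h⟩
    exact ⟨(ℓ.1, ℓ.2), by simpa [delVar] using hℓ, h⟩
  · rintro ⟨⟨v, p⟩, hℓ, hp⟩
    obtain rfl : σ v = p := hp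
    by_cases hvb : v = b
    · subst hvb
      refine ⟨(⟨a, hab⟩, σ a), ?_, rfl⟩
      simpa [delVar, htwin C hC, ← hσ] using hℓ
    · exact ⟨(⟨v, hvb⟩, σ v), by simpa [delVar] using hℓ, rfl⟩

/-- Restriction to `V \ {b}` identifies the satisfying assignments in which the values of the
twins agree up to `c` with the satisfying assignments of the reduced formula. -/
def agreeingSatEquiv {V : Type*} [Fintype V] [DecidableEq V]
    {φ : Finset (Finset (V × Bool))} {a b : V} {c : Bool} (hab : a ≠ b)
    (htwin : ∀ C ∈ φ, ∀ p, (a, p) ∈ C ↔ (b, p ^^ c) ∈ C) :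
    {σ : {σ : V → Bool // SatFormula σ φ} // σ.1 b = (σ.1 a ^^ c)} ≃
      {τ : {v : V // v ≠ b} → Bool // SatFormula τ (φ.image (delVar b))} where
  toFun σ := ⟨fun v => σ.1.1 v, (satFormula_image_delVar_iff hab htwin σ.2).2 σ.1.2⟩
  invFun τ := ⟨⟨extendXor hab c τ.1, (satFormula_image_delVar_iff hab htwin
      (by simp [extendXor, hab])).1 (by
        convert τ.2 using 2 with v
        simp [extendXor, v.2])⟩, by simp [extendXor, hab]⟩
  left_inv σ := by
    ext v
    by_cases hvb : v = b
    · subst hvb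
      simp [extendXor, σ.2]
    · simp [extendXor, hvb]
  right_inv τ := by
    ext v
    simp [extendXor, v.2]

/-- Correctness of the twins rule: if the literals `(a, pa)` and `(b, pb)` of distinct
variables `a, b` are twins in `φ` (every clause contains `(a, pa)` iff it contains `(b, pb)`,
and contains the negation `(a, !pa)` iff it contains `(b, !pb)`), then deleting both literals
of `b` from every clause yields a formula `φ'` over `V \ {b}` with
`#sat(φ) ≡ #sat(φ') (mod 2)`, where `#sat(φ')` counts assignments of `V \ {b}`. -/
theorem twins_rule (V : Type*) [Fintype V] [DecidableEq V]
    (φ : Finset (Finset (V × Bool))) (a b : V) (pa pb : Bool) (hab : a ≠ b)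
    (htwin : ∀ C ∈ φ, ((a, pa) ∈ C ↔ (b, pb) ∈ C) ∧ ((a, !pa) ∈ C ↔ (b, !pb) ∈ C)) :
    numSat V φ ≡ numSat {v : V // v ≠ b} (φ.image (delVar b)) [MOD 2] := by
  classical
  have htwin' : ∀ C ∈ φ, ∀ p, (a, p) ∈ C ↔ (b, p ^^ (pa ^^ pb)) ∈ C := by
    intro C hC p
    obtain ⟨h₁, h₂⟩ := htwin C hC
    cases p <;> cases pa <;> cases pb <;> simp_all
  let f : Function.End {σ : V → Bool // SatFormula σ φ} :=
    fun σ => ⟨swapXor a b (pa ^^ pb) σ.1, σ.2.swapXor hab htwin'⟩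
  have hf : f ^ 2 ^ 1 = 1 := by
    funext σ
    exact Subtype.ext (swapXor_involutive hab _ σ.1)
  have hfix : ∀ σ, σ ∈ Function.fixedPoints f ↔ σ.1 b = (σ.1 a ^^ (pa ^^ pb)) := fun σ =>
    Subtype.ext_iff.trans (swapXor_eq_self_iff _ _)
  have hcard := Equiv.Perm.card_fixedPoints_modEq hf
  rwa [← Nat.card_eq_fintype_card, ← Nat.card_eq_fintype_card,
    Nat.card_congr ((Equiv.subtypeEquivRight hfix).trans (agreeingSatEquiv hab htwin'))] at hcard
end

section
/- Correctness of the complementary-2-clauses substitution: let φ be a CNF formula over a finite variable set V containing the two 2-clauses (x ∨ y) and (¬x ∨ ¬y) for distinct variables x, y ∈ V. Then every assignment σ : V → Bool satisfying φ has σ(x) ≠ σ(y). Moreover, letting φ' be the CNF formula over V \ {x} obtained from φ by replacing every occurrence of the literal x by ¬y and every occurrence of ¬x by y, and then deleting every clause containing both y and ¬y, the number of assignments of V satisfying φ equals the number of assignments of V \ {x} satisfying φ'. -/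
/-- The clause over `V \ {x}` obtained from the clause `C` by replacing every occurrence of
the literal `x` (i.e. `(x, true)`) by `¬y` (i.e. `(y, false)`) and every occurrence of `¬x`
(i.e. `(x, false)`) by `y` (i.e. `(y, true)`): a literal `(v, p)` with `v ≠ x` belongs to the
resulting clause iff `(v, p) ∈ C`, or `v = y` and `(x, !p) ∈ C`. -/
def substClause {V : Type*} [Fintype V] [DecidableEq V] (x y : V) (C : Finset (V × Bool)) :
    Finset ({v : V // v ≠ x} × Bool) :=
  Finset.univ.filter (fun ℓ' => ((ℓ'.1 : V), ℓ'.2) ∈ C ∨ ((ℓ'.1 : V) = y ∧ (x, !ℓ'.2) ∈ C))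

/-- Under an assignment giving `x` and `y` opposite values, substituting `¬y` for `x` in a
clause does not change whether the clause is satisfied. -/
theorem satClause_substClause {V : Type*} [Fintype V] [DecidableEq V] {x y : V} (hxy : x ≠ y)
    {σ : V → Bool} (hσ : σ x = !σ y) (C : Finset (V × Bool)) :
    SatClause (fun v : {v : V // v ≠ x} => σ v) (substClause x y C) ↔ SatClause σ C := by
  constructor
  · rintro ⟨⟨⟨v, hv⟩, p⟩, hmem, hp⟩
    rcases (Finset.mem_filter.mp hmem).2 with h | ⟨rfl, h⟩
    · exact ⟨(v, p), h, hp⟩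
    · exact ⟨(x, !p), h, hσ.trans (congrArg _ hp)⟩
  · rintro ⟨⟨v, p⟩, hmem, hp⟩
    by_cases hv : v = x
    · subst hv
      refine ⟨(⟨y, hxy.symm⟩, !p), Finset.mem_filter.mpr ⟨Finset.mem_univ _, Or.inr ⟨rfl, ?_⟩⟩, ?_⟩
      · simpa using hmem
      · simp_all
    · exact ⟨(⟨v, hv⟩, p), Finset.mem_filter.mpr ⟨Finset.mem_univ _, Or.inl hmem⟩, hp⟩

/-- A clause containing both `y` and `¬y` is satisfied by every assignment. -/
theorem satClause_of_mem_of_mem {V : Type*} {y : V} {C : Finset (V × Bool)}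
    (ht : (y, true) ∈ C) (hf : (y, false) ∈ C) (σ : V → Bool) : SatClause σ C := by
  cases h : σ y
  · exact ⟨_, hf, h⟩
  · exact ⟨_, ht, h⟩

/-- Deleting the clauses containing both `y` and `¬y` does not change the satisfying
assignments. -/
theorem satFormula_filter_not_taut {V : Type*} [DecidableEq V] (y : V)
    (φ : Finset (Finset (V × Bool))) (σ : V → Bool) :
    SatFormula σ (φ.filter fun C => ¬((y, true) ∈ C ∧ (y, false) ∈ C)) ↔ SatFormula σ φ := by
  refine ⟨fun h C hC => ?_, fun h C hC => h C (Finset.mem_filter.mp hC).1⟩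
  by_cases hy : (y, true) ∈ C ∧ (y, false) ∈ C
  · exact satClause_of_mem_of_mem hy.1 hy.2 σ
  · exact h C (Finset.mem_filter.mpr ⟨hC, hy⟩)

/-- Under an assignment giving `x` and `y` opposite values, substituting `¬y` for `x` in a
formula does not change whether the formula is satisfied. -/
theorem satFormula_image_substClause {V : Type*} [Fintype V] [DecidableEq V] {x y : V}
    (hxy : x ≠ y) {σ : V → Bool} (hσ : σ x = !σ y) (φ : Finset (Finset (V × Bool))) :
    SatFormula (fun v : {v : V // v ≠ x} => σ v) (φ.image (substClause x y)) ↔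
      SatFormula σ φ := by
  simp only [SatFormula, Finset.forall_mem_image, satClause_substClause hxy hσ]

/-- An assignment satisfying `(x ∨ y)` and `(¬x ∨ ¬y)` gives `x` and `y` opposite values. -/
theorem eq_not_of_satClause_pair {V : Type*} [DecidableEq V] {x y : V} {σ : V → Bool}
    (h1 : SatClause σ {(x, true), (y, true)}) (h2 : SatClause σ {(x, false), (y, false)}) :
    σ x = !σ y := by
  simp only [SatClause, Finset.mem_insert, Finset.mem_singleton, exists_eq_or_imp,
    exists_eq_left] at h1 h2
  cases hx : σ x <;> cases hy : σ y <;> simp_all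

/-- Correctness of the complementary-2-clauses substitution: if `φ` contains the 2-clauses
`(x ∨ y)` and `(¬x ∨ ¬y)` for distinct variables `x, y`, then every satisfying assignment
has `σ x ≠ σ y`; moreover, replacing every occurrence of the literal `x` by `¬y` and of
`¬x` by `y`, and then deleting every clause containing both `y` and `¬y`, yields a formula
`φ'` over `V \ {x}` whose number of satisfying assignments (over `V \ {x}`) equals the
number of assignments of `V` satisfying `φ`. -/
theorem complementary_two_clauses (V : Type*) [Fintype V] [DecidableEq V]
    (φ : Finset (Finset (V × Bool))) (x y : V) (hxy : x ≠ y)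
    (h1 : ({(x, true), (y, true)} : Finset (V × Bool)) ∈ φ)
    (h2 : ({(x, false), (y, false)} : Finset (V × Bool)) ∈ φ) :
    (∀ σ : V → Bool, SatFormula σ φ → σ x ≠ σ y) ∧
    numSat V φ =
      numSat {v : V // v ≠ x}
        ((φ.image (substClause x y)).filter
          (fun C' => ¬((⟨y, Ne.symm hxy⟩, true) ∈ C' ∧ (⟨y, Ne.symm hxy⟩, false) ∈ C'))) := by
  have hopp : ∀ σ : V → Bool, SatFormula σ φ → σ x = !σ y := fun σ hσ =>
    eq_not_of_satClause_pair (hσ _ h1) (hσ _ h2)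
  refine ⟨fun σ hσ => by simp [hopp σ hσ], ?_⟩
  let extend (τ : {v : V // v ≠ x} → Bool) (v : V) : Bool :=
    if hv : v = x then !τ ⟨y, hxy.symm⟩ else τ ⟨v, hv⟩
  have extend_restrict : ∀ τ, (fun v : {v : V // v ≠ x} => extend τ v) = τ := fun τ =>
    funext fun v => dif_neg v.2
  have extend_opp : ∀ τ, extend τ x = !extend τ y := fun τ => by
    simp [extend, hxy.symm]
  refine Nat.card_congr
    { toFun := fun σ => ⟨fun v => σ.1 v, (satFormula_filter_not_taut _ _ _).mpr
        ((satFormula_image_substClause hxy (hopp _ σ.2) φ).mpr σ.2)⟩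
      invFun := fun τ => ⟨extend τ.1, (satFormula_image_substClause hxy (extend_opp _) φ).mp
        (by simpa only [extend_restrict] using (satFormula_filter_not_taut _ _ _).mp τ.2)⟩
      left_inv := fun σ => Subtype.ext (funext fun v => ?_)
      right_inv := fun τ => Subtype.ext (extend_restrict τ.1) }
  by_cases hv : v = x
  · subst hv
    simp [extend, hopp _ σ.2]
  · simp [extend, hv]
end

section
/- Correctness of the isolate rule: let V be a finite set of Boolean variables partitioned into disjoint subsets V₁ and V₂ with V₁ ∪ V₂ = V, and let φ = φ₁ ∪ φ₂ be a CNF formula over V such that every clause of φ₁ uses only variables in V₁ and every clause of φ₂ uses only variables in V₂. Then #sat(φ) (counting assignments of V) equals #sat(φ₁) · #sat(φ₂), where #sat(φᵢ) counts assignments of Vᵢ satisfying φᵢ. -/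
/-- An assignment of the variable subset `W` satisfies a clause `C` (all of whose variables
are assumed to lie in `W`) if it makes at least one literal of `C` true. -/
def SatClauseOn {V : Type*} (W : Finset V) (σ : {v : V // v ∈ W} → Bool)
    (C : Finset (V × Bool)) : Prop :=
  ∃ ℓ ∈ C, ∃ h : ℓ.1 ∈ W, σ ⟨ℓ.1, h⟩ = ℓ.2

/-- `numSatOn W φ` is the number of assignments of the variable subset `W` that satisfy
every clause of `φ`. -/
noncomputable def numSatOn {V : Type*} (W : Finset V) (φ : Finset (Finset (V × Bool))) : ℕ :=
  Nat.card {σ : {v : V // v ∈ W} → Bool // ∀ C ∈ φ, SatClauseOn W σ C}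

/-- On a clause whose variables all lie in `W`, satisfaction by the restriction of `σ` to `W`
agrees with satisfaction by `σ`. -/
theorem satClauseOn_restrict_iff {V : Type*} {W : Finset V} {C : Finset (V × Bool)}
    (hC : ∀ ℓ ∈ C, ℓ.1 ∈ W) (σ : V → Bool) :
    SatClauseOn W (fun v => σ v) C ↔ SatClause σ C :=
  ⟨fun ⟨ℓ, hℓ, _, h⟩ => ⟨ℓ, hℓ, h⟩, fun ⟨ℓ, hℓ, h⟩ => ⟨ℓ, hℓ, hC ℓ hℓ, h⟩⟩

/-- Assignments of `V` correspond to pairs of assignments of the two parts of a partition. -/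
def assignmentEquivProd {V : Type*} [Fintype V] [DecidableEq V] {V₁ V₂ : Finset V}
    (hdisj : Disjoint V₁ V₂) (hunion : V₁ ∪ V₂ = Finset.univ) :
    (V → Bool) ≃ ({v : V // v ∈ V₁} → Bool) × ({v : V // v ∈ V₂} → Bool) where
  toFun σ := (fun v => σ v, fun v => σ v)
  invFun τ v :=
    if h : v ∈ V₁ then τ.1 ⟨v, h⟩
    else τ.2 ⟨v, (Finset.mem_union.1 (hunion ▸ Finset.mem_univ v)).resolve_left h⟩
  left_inv σ := by
    funext v
    simp
  right_inv τ := by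
    refine Prod.ext (funext fun v => ?_) (funext fun v => ?_)
    · simp
    · simp [Finset.disjoint_right.1 hdisj v.2]

/-- Correctness of the isolate rule: if `V` is partitioned into disjoint `V₁` and `V₂`,
every clause of `φ₁` uses only variables of `V₁`, and every clause of `φ₂` uses only
variables of `V₂`, then `#sat(φ₁ ∪ φ₂)` (counting assignments of `V`) equals
`#sat(φ₁) · #sat(φ₂)` (counting assignments of `V₁` and `V₂` respectively). -/
theorem isolate_rule (V : Type*) [Fintype V] [DecidableEq V]
    (V₁ V₂ : Finset V) (hdisj : Disjoint V₁ V₂) (hunion : V₁ ∪ V₂ = Finset.univ)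
    (φ₁ φ₂ : Finset (Finset (V × Bool)))
    (h₁ : ∀ C ∈ φ₁, ∀ ℓ ∈ C, ℓ.1 ∈ V₁)
    (h₂ : ∀ C ∈ φ₂, ∀ ℓ ∈ C, ℓ.1 ∈ V₂) :
    numSat V (φ₁ ∪ φ₂) = numSatOn V₁ φ₁ * numSatOn V₂ φ₂ := by
  unfold numSat numSatOn
  rw [← Nat.card_prod]
  refine Nat.card_congr (((assignmentEquivProd hdisj hunion).subtypeEquiv fun σ => ?_).trans
    (Equiv.subtypeProdEquivProd (p := fun τ => ∀ C ∈ φ₁, SatClauseOn V₁ τ C)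
      (q := fun τ => ∀ C ∈ φ₂, SatClauseOn V₂ τ C)))
  simp only [SatFormula, Finset.forall_mem_union]
  exact and_congr
    (forall₂_congr fun C hC => (satClauseOn_restrict_iff (h₁ C hC) σ).symm)
    (forall₂_congr fun C hC => (satClauseOn_restrict_iff (h₂ C hC) σ).symm)
end

section
/- Correctness of the semi-isolate rule: let V be a finite set of Boolean variables, let V₁, V₂ ⊆ V with V₁ ∪ V₂ = V and V₁ ∩ V₂ = {x} for a single variable x, and let φ = φ₁ ∪ φ₂ be a CNF formula over V such that every clause of φ₁ uses only variables in V₁ and every clause of φ₂ uses only variables in V₂. Then #sat(φ) (counting assignments of V) equals Σ_{b ∈ {false, true}} (number of assignments σ₁ : V₁ → Bool with σ₁(x) = b satisfying φ₁) · (number of assignments σ₂ : V₂ → Bool with σ₂(x) = b satisfying φ₂). -/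
/-- Satisfying a union of formulas over `V₁` and `V₂` means that the two restrictions satisfy
the respective formulas. -/
theorem satFormula_union_iff {V : Type*} [DecidableEq V] {V₁ V₂ : Finset V}
    {φ₁ φ₂ : Finset (Finset (V × Bool))}
    (h₁ : ∀ C ∈ φ₁, ∀ ℓ ∈ C, ℓ.1 ∈ V₁) (h₂ : ∀ C ∈ φ₂, ∀ ℓ ∈ C, ℓ.1 ∈ V₂) (σ : V → Bool) :
    SatFormula σ (φ₁ ∪ φ₂) ↔
      (∀ C ∈ φ₁, SatClauseOn V₁ (fun v => σ v) C) ∧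
        ∀ C ∈ φ₂, SatClauseOn V₂ (fun v => σ v) C := by
  have e₁ : ∀ C ∈ φ₁, (SatClauseOn V₁ (fun v => σ v) C ↔ SatClause σ C) :=
    fun C hC => satClauseOn_restrict_iff (h₁ C hC) σ
  have e₂ : ∀ C ∈ φ₂, (SatClauseOn V₂ (fun v => σ v) C ↔ SatClause σ C) :=
    fun C hC => satClauseOn_restrict_iff (h₂ C hC) σ
  rw [forall₂_congr e₁, forall₂_congr e₂]
  simp only [SatFormula, Finset.mem_union, or_imp, forall_and]

/-- Assignments of `V₁` and `V₂` that agree at the only common variable have a common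
extension to `V₁ ∪ V₂ = V`. -/
theorem exists_common_extension {V : Type*} [Fintype V] [DecidableEq V] {V₁ V₂ : Finset V}
    {x : V} (hunion : V₁ ∪ V₂ = Finset.univ) (hint : V₁ ∩ V₂ = {x}) (hx₁ : x ∈ V₁) (hx₂ : x ∈ V₂)
    (σ₁ : {v : V // v ∈ V₁} → Bool) (σ₂ : {v : V // v ∈ V₂} → Bool)
    (hσ : σ₁ ⟨x, hx₁⟩ = σ₂ ⟨x, hx₂⟩) :
    ∃ σ : V → Bool, (fun v : {v : V // v ∈ V₁} => σ v) = σ₁ ∧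
      (fun v : {v : V // v ∈ V₂} => σ v) = σ₂ := by
  have hcover : ∀ v, v ∉ V₁ → v ∈ V₂ := fun v hv =>
    (Finset.mem_union.1 (hunion ▸ Finset.mem_univ v)).resolve_left hv
  refine ⟨fun v => if h : v ∈ V₁ then σ₁ ⟨v, h⟩ else σ₂ ⟨v, hcover v h⟩, ?_, ?_⟩
  · funext ⟨v, hv⟩
    simp [hv]
  · funext ⟨v, hv⟩
    by_cases h : v ∈ V₁
    · obtain rfl : v = x := Finset.mem_singleton.1 (hint ▸ Finset.mem_inter.2 ⟨h, hv⟩)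
      simpa [h] using hσ
    · simp [h]

/-- Correctness of the semi-isolate rule: if `V₁ ∪ V₂ = V` and `V₁ ∩ V₂ = {x}`, every clause
of `φ₁` uses only variables of `V₁`, and every clause of `φ₂` uses only variables of `V₂`,
then `#sat(φ₁ ∪ φ₂)` (counting assignments of `V`) equals
`Σ_{b ∈ {false,true}} (#assignments of V₁ with σ₁(x) = b satisfying φ₁) ·
(#assignments of V₂ with σ₂(x) = b satisfying φ₂)`. -/
theorem semi_isolate_rule (V : Type*) [Fintype V] [DecidableEq V]
    (V₁ V₂ : Finset V) (x : V)
    (hunion : V₁ ∪ V₂ = Finset.univ) (hint : V₁ ∩ V₂ = {x})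
    (hx₁ : x ∈ V₁) (hx₂ : x ∈ V₂)
    (φ₁ φ₂ : Finset (Finset (V × Bool)))
    (h₁ : ∀ C ∈ φ₁, ∀ ℓ ∈ C, ℓ.1 ∈ V₁)
    (h₂ : ∀ C ∈ φ₂, ∀ ℓ ∈ C, ℓ.1 ∈ V₂) :
    numSat V (φ₁ ∪ φ₂) =
      ∑ b : Bool,
        Nat.card {σ₁ : {v : V // v ∈ V₁} → Bool //
            σ₁ ⟨x, hx₁⟩ = b ∧ ∀ C ∈ φ₁, SatClauseOn V₁ σ₁ C} *
        Nat.card {σ₂ : {v : V // v ∈ V₂} → Bool //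
            σ₂ ⟨x, hx₂⟩ = b ∧ ∀ C ∈ φ₂, SatClauseOn V₂ σ₂ C} := by
  have hcover : ∀ v, v ∈ V₁ ∨ v ∈ V₂ := fun v =>
    Finset.mem_union.1 (hunion ▸ Finset.mem_univ v)
  simp_rw [← Nat.card_prod]
  rw [← Nat.card_sigma, numSat]
  refine Nat.card_congr (Equiv.ofBijective (fun σ => ⟨σ.1 x,
    ⟨fun v => σ.1 v, rfl, ((satFormula_union_iff h₁ h₂ σ.1).1 σ.2).1⟩,
    ⟨fun v => σ.1 v, rfl, ((satFormula_union_iff h₁ h₂ σ.1).1 σ.2).2⟩⟩) ⟨?_, ?_⟩)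
  · intro σ τ h
    have e₁ := congrArg (fun p => p.2.1.1) h
    have e₂ := congrArg (fun p => p.2.2.1) h
    refine Subtype.ext (funext fun v => ?_)
    rcases hcover v with hv | hv
    · exact congrFun e₁ ⟨v, hv⟩
    · exact congrFun e₂ ⟨v, hv⟩
  · rintro ⟨b, ⟨σ₁, hb₁, hs₁⟩, ⟨σ₂, hb₂, hs₂⟩⟩
    obtain ⟨σ, rfl, rfl⟩ :=
      exists_common_extension hunion hint hx₁ hx₂ σ₁ σ₂ (hb₁.trans hb₂.symm)
    subst hb₁
    exact ⟨⟨σ, (satFormula_union_iff h₁ h₂ σ).2 ⟨hs₁, hs₂⟩⟩, rfl⟩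
end

section
/- Domination of branching factors: let a₁, a₂ > 0 and p > q > 0 be real numbers with a₁ + a₂ ≥ p and min(a₁, a₂) ≥ q. Let x₁ > 1 be the unique real number with x₁^{-a₁} + x₁^{-a₂} = 1 and let x₂ > 1 be the unique real number with x₂^{-(p−q)} + x₂^{-q} = 1. Then x₁ ≤ x₂, i.e., τ(a₁, a₂) ≤ τ(p − q, q). -/
/-- At a fixed base `x > 1`, the sum `x^{-a₁} + x^{-a₂}` is at most `x^{-(p-q)} + x^{-q}`
when `p ≤ a₁ + a₂` and both exponents are at least `q`. -/
lemma rpow_neg_add_rpow_neg_le {a₁ a₂ p q x : ℝ} (hx : 1 < x) (hsum : p ≤ a₁ + a₂)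
    (h₁ : q ≤ a₁) (h₂ : q ≤ a₂) :
    x ^ (-a₁) + x ^ (-a₂) ≤ x ^ (-(p - q)) + x ^ (-q) := by
  have hx0 : 0 < x := by linarith
  have hu : x ^ (-a₁) ≤ x ^ (-q) := Real.rpow_le_rpow_of_exponent_le hx.le (by linarith)
  have hv : x ^ (-a₂) ≤ x ^ (-q) := Real.rpow_le_rpow_of_exponent_le hx.le (by linarith)
  have huv : x ^ (-a₁) * x ^ (-a₂) ≤ x ^ (-(p - q)) * x ^ (-q) := by
    rw [← Real.rpow_add hx0, ← Real.rpow_add hx0]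
    exact Real.rpow_le_rpow_of_exponent_le hx.le (by linarith)
  refine le_of_mul_le_mul_right ?_ (Real.rpow_pos_of_pos hx0 (-q))
  nlinarith [mul_nonneg (sub_nonneg.2 hu) (sub_nonneg.2 hv)]

/-- Domination of branching factors: if `a₁, a₂ > 0`, `p > q > 0`, `a₁ + a₂ ≥ p` and
`min(a₁, a₂) ≥ q`, and `x₁ > 1` satisfies `x₁^{-a₁} + x₁^{-a₂} = 1` while `x₂ > 1`
satisfies `x₂^{-(p-q)} + x₂^{-q} = 1`, then `τ(a₁, a₂) = x₁ ≤ x₂ = τ(p − q, q)`. -/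
theorem branching_factor_dominate (a₁ a₂ p q x₁ x₂ : ℝ)
    (ha₁ : 0 < a₁) (ha₂ : 0 < a₂) (hq : 0 < q) (hpq : q < p)
    (hsum : p ≤ a₁ + a₂) (hmin : q ≤ min a₁ a₂)
    (hx₁ : 1 < x₁) (hx₁eq : x₁ ^ (-a₁) + x₁ ^ (-a₂) = 1)
    (hx₂ : 1 < x₂) (hx₂eq : x₂ ^ (-(p - q)) + x₂ ^ (-q) = 1) :
    x₁ ≤ x₂ := by
  by_contra! hlt
  have hx₂0 : 0 < x₂ := by linarith
  have hle := rpow_neg_add_rpow_neg_le hx₁ hsum (le_min_iff.1 hmin).1 (le_min_iff.1 hmin).2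
  have hpq' : x₁ ^ (-(p - q)) < x₂ ^ (-(p - q)) :=
    Real.rpow_lt_rpow_of_neg hx₂0 hlt (by linarith)
  have hq' : x₁ ^ (-q) < x₂ ^ (-q) := Real.rpow_lt_rpow_of_neg hx₂0 hlt (by linarith)
  linarith
end

section
/- Parity equivalence of vertex covers and edge covers: for every finite simple graph G, the number of vertex covers of G is congruent modulo 2 to the number of edge covers of G, i.e., #vc(G) ≡ #ec(G) (mod 2). -/
open Finset in
/-- Modulo 2, the subsets of `s` hitting every element of `t` are counted by the pairs `(S, T)` of
subsets with no incidence between them. -/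
theorem card_hitting_subsets_eq_sum {α β : Type*} (r : α → β → Prop)
    [∀ a b, Decidable (r a b)] (s : Finset α) (t : Finset β) :
    (#{S ∈ s.powerset | ∀ b ∈ t, ∃ a ∈ S, r a b} : ZMod 2) =
      ∑ S ∈ s.powerset, ∑ T ∈ t.powerset, if ∀ a ∈ S, ∀ b ∈ T, ¬ r a b then 1 else 0 := by
  rw [Finset.natCast_card_filter]
  refine Finset.sum_congr rfl fun S _ => ?_
  have hT : {T ∈ t.powerset | ∀ a ∈ S, ∀ b ∈ T, ¬ r a b} =
      ({b ∈ t | ∀ a ∈ S, ¬ r a b} : Finset β).powerset := by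
    ext T
    simp only [mem_filter, mem_powerset, subset_iff]
    grind
  rw [← Finset.natCast_card_filter, hT, card_powerset, Nat.cast_pow,
    show ((2 : ℕ) : ZMod 2) = 0 from rfl, zero_pow_eq]
  refine if_congr ?_ rfl rfl
  simp [card_eq_zero, filter_eq_empty_iff]

open Finset in
/-- For a relation between two finite sets, the numbers of hitting sets on either side have the
same parity. -/
theorem card_hitting_subsets_modEq {α β : Type*} (r : α → β → Prop)
    [∀ a b, Decidable (r a b)] (s : Finset α) (t : Finset β) :
    #{S ∈ s.powerset | ∀ b ∈ t, ∃ a ∈ S, r a b} ≡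
      #{T ∈ t.powerset | ∀ a ∈ s, ∃ b ∈ T, r a b} [MOD 2] := by
  rw [← ZMod.natCast_eq_natCast_iff, card_hitting_subsets_eq_sum r,
    card_hitting_subsets_eq_sum (fun b a => r a b), sum_comm]
  refine sum_congr rfl fun T _ => sum_congr rfl fun S _ => if_congr ?_ rfl rfl
  grind

/-- Parity equivalence of vertex covers and edge covers: for every finite simple graph `G`,
the number of vertex covers of `G` (sets of vertices containing at least one endpoint of
every edge) is congruent mod 2 to the number of edge covers of `G` (sets of edges such that
every vertex is an endpoint of at least one edge of the set). -/
theorem vertex_cover_edge_cover_parity (V : Type*) [Fintype V] [DecidableEq V]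
    (G : SimpleGraph V) :
    Nat.card {S : Finset V // ∀ u v : V, G.Adj u v → u ∈ S ∨ v ∈ S} ≡
    Nat.card {F : Finset (Sym2 V) //
        (∀ e ∈ F, e ∈ G.edgeSet) ∧ ∀ v : V, ∃ e ∈ F, v ∈ e} [MOD 2] := by
  classical
  convert card_hitting_subsets_modEq (fun (v : V) (e : Sym2 V) => v ∈ e)
    Finset.univ G.edgeFinset using 1
  · rw [Nat.card_eq_fintype_card, Fintype.card_subtype]
    congr 1
    ext S
    simp only [Finset.mem_filter, Finset.mem_univ, Finset.powerset_univ, true_and,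
      SimpleGraph.mem_edgeFinset, Sym2.forall, SimpleGraph.mem_edgeSet, Sym2.mem_iff]
    grind
  · rw [Nat.card_eq_fintype_card, Fintype.card_subtype]
    congr 1
    ext F
    simp [Finset.subset_iff]
end

section
/- Bisection width of cubic multigraphs from the simple-graph case: let V be a finite set of n vertices, let w : V × V → ℕ be a symmetric edge-multiplicity function with w(v, v) = 0 for all v, and suppose the multigraph G = (V, w) is cubic, i.e., Σ_{u ∈ V} w(v, u) = 3 for every v ∈ V. Let ε > 0 with n ≥ 6/ε. Suppose there is a partition (A', B') of V with | |A'| − |B'| | ≤ 1 such that the number of unordered pairs {u, v} with u ∈ A', v ∈ B', and w(u, v) ≥ 1 is at most (1/6 + ε/2)·n. Then there exists a partition (A, B) of V with | |A| − |B| | ≤ 1 such that Σ_{u ∈ A, v ∈ B} w(u, v) ≤ (1/6 + ε)·n. -/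
/-- The total weight of the edges between `A` and its complement. -/
def cutWeight {V : Type*} [Fintype V] [DecidableEq V] (f : V → V → ℕ) (A : Finset V) : ℕ :=
  ∑ a ∈ A, ∑ b ∈ Aᶜ, f a b

/-- The edge indicator of the underlying simple graph of a multigraph. -/
def simpleWeight {V : Type*} (w : V → V → ℕ) (u v : V) : ℕ :=
  if 1 ≤ w u v then 1 else 0

theorem simpleWeight_comm {V : Type*} {w : V → V → ℕ} (hsymm : ∀ u v, w u v = w v u) (u v : V) :
    simpleWeight w u v = simpleWeight w v u := by
  simp only [simpleWeight, hsymm u v]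

theorem simpleWeight_le {V : Type*} (w : V → V → ℕ) (u v : V) : simpleWeight w u v ≤ w u v := by
  unfold simpleWeight
  split_ifs <;> omega

section Cut

variable {V : Type*} [Fintype V] [DecidableEq V]

theorem cutWeight_compl {f : V → V → ℕ} (hf : ∀ u v, f u v = f v u) (A : Finset V) :
    cutWeight f Aᶜ = cutWeight f A := by
  unfold cutWeight
  rw [compl_compl, Finset.sum_comm]
  exact Finset.sum_congr rfl fun a _ => Finset.sum_congr rfl fun b _ => hf b a

theorem cutWeight_erase_add {f : V → V → ℕ} (hf : ∀ u v, f u v = f v u) {A : Finset V} {u : V}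
    (hu : u ∈ A) :
    cutWeight f (A.erase u) + ∑ b ∈ Aᶜ, f u b = cutWeight f A + ∑ a ∈ A.erase u, f u a := by
  have hcompl : ∀ a, ∑ b ∈ (A.erase u)ᶜ, f a b = f u a + ∑ b ∈ Aᶜ, f a b := fun a => by
    rw [Finset.compl_erase, Finset.sum_insert (by simpa using hu), hf]
  have hA := Finset.add_sum_erase A (fun a => ∑ b ∈ Aᶜ, f a b) hu
  simp only [cutWeight, hcompl, Finset.sum_add_distrib, ← hA]
  ring

/-- In a cubic multigraph, moving an endpoint of a multiple edge of the cut to the other side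
does not increase the simple cut and strictly decreases the multigraph cut. -/
theorem cutWeight_erase_of_two_le {w : V → V → ℕ} (hsymm : ∀ u v, w u v = w v u)
    (hcubic : ∀ v, ∑ u : V, w v u = 3) {A : Finset V} {u v : V} (hu : u ∈ A) (hv : v ∉ A)
    (huv : 2 ≤ w u v) :
    cutWeight (simpleWeight w) (A.erase u) ≤ cutWeight (simpleWeight w) A ∧
      cutWeight w (A.erase u) < cutWeight w A := by
  have hM := cutWeight_erase_add hsymm hu
  have hS := cutWeight_erase_add (simpleWeight_comm hsymm) hu
  have hv' : v ∈ Aᶜ := by simpa using hv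
  have hsplit := Finset.sum_add_sum_compl A (w u)
  rw [hcubic] at hsplit
  have hout : w u v ≤ ∑ b ∈ Aᶜ, w u b :=
    Finset.single_le_sum (f := w u) (fun _ _ => Nat.zero_le _) hv'
  have hsout : simpleWeight w u v ≤ ∑ b ∈ Aᶜ, simpleWeight w u b :=
    Finset.single_le_sum (f := simpleWeight w u) (fun _ _ => Nat.zero_le _) hv'
  have hone : simpleWeight w u v = 1 := if_pos (by omega)
  have hin : ∑ a ∈ A.erase u, w u a ≤ ∑ a ∈ A, w u a :=
    Finset.sum_le_sum_of_subset (Finset.erase_subset u A)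
  have hsin : ∑ a ∈ A.erase u, simpleWeight w u a ≤ ∑ a ∈ A.erase u, w u a :=
    Finset.sum_le_sum fun a _ => simpleWeight_le w u a
  omega

theorem cutWeight_insert_of_two_le {w : V → V → ℕ} (hsymm : ∀ u v, w u v = w v u)
    (hcubic : ∀ v, ∑ u : V, w v u = 3) {A : Finset V} {u v : V} (hu : u ∈ A) (hv : v ∉ A)
    (huv : 2 ≤ w u v) :
    cutWeight (simpleWeight w) (insert v A) ≤ cutWeight (simpleWeight w) A ∧
      cutWeight w (insert v A) < cutWeight w A := by
  have h := cutWeight_erase_of_two_le hsymm hcubic (A := Aᶜ) (u := v) (v := u)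
    (by simpa using hv) (by simpa using hu) (hsymm u v ▸ huv)
  rwa [← Finset.compl_insert, cutWeight_compl hsymm, cutWeight_compl hsymm,
    cutWeight_compl (simpleWeight_comm hsymm), cutWeight_compl (simpleWeight_comm hsymm)] at h

/-- If all multiple edges of the cut leave a single vertex of `A`, then the multigraph cut
exceeds the simple cut by at most `3`. -/
theorem cutWeight_le_simple_add_three {w : V → V → ℕ} (hcubic : ∀ v, ∑ u : V, w v u = 3)
    {A : Finset V}
    (huniq : ∀ u ∈ A, ∀ v ∉ A, ∀ u' ∈ A, ∀ v' ∉ A, 2 ≤ w u v → 2 ≤ w u' v' → u = u') :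
    cutWeight w A ≤ cutWeight (simpleWeight w) A + 3 := by
  have hle : ∀ a b, w a b < 2 → w a b ≤ simpleWeight w a b := fun a b h => by
    unfold simpleWeight
    split_ifs <;> omega
  by_cases hex : ∃ u ∈ A, ∃ v ∉ A, 2 ≤ w u v
  · obtain ⟨u, hu, v, hv, huv⟩ := hex
    unfold cutWeight
    rw [← Finset.add_sum_erase A _ hu, ← Finset.add_sum_erase A (fun a => ∑ b ∈ Aᶜ, _) hu]
    have hrow : ∑ b ∈ Aᶜ, w u b ≤ 3 :=
      (Finset.sum_le_sum_of_subset (Finset.subset_univ _)).trans_eq (hcubic u)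
    have hrest : ∑ a ∈ A.erase u, ∑ b ∈ Aᶜ, w a b ≤
        ∑ a ∈ A.erase u, ∑ b ∈ Aᶜ, simpleWeight w a b := by
      refine Finset.sum_le_sum fun a ha => Finset.sum_le_sum fun b hb => hle a b ?_
      by_contra! hab
      exact (Finset.mem_erase.1 ha).1 (huniq a (Finset.mem_erase.1 ha).2 b
        (Finset.mem_compl.1 hb) u hu v hv hab huv)
    omega
  · push Not at hex
    exact le_add_right (Finset.sum_le_sum fun a ha => Finset.sum_le_sum fun b hb =>
      hle a b (hex a ha b (Finset.mem_compl.1 hb)))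

/-- In a cubic multigraph, every vertex set can be replaced by one of the same size whose multigraph
cut exceeds the simple cut of the original by at most `3`. -/
theorem exists_card_eq_cutWeight_le {w : V → V → ℕ} (hsymm : ∀ u v, w u v = w v u)
    (hcubic : ∀ v, ∑ u : V, w v u = 3) (A₀ : Finset V) :
    ∃ A : Finset V, A.card = A₀.card ∧
      cutWeight w A ≤ cutWeight (simpleWeight w) A₀ + 3 := by
  obtain ⟨A, hA, hmin⟩ := Finset.exists_min_image
    ({A | A.card = A₀.card ∧
      cutWeight (simpleWeight w) A ≤ cutWeight (simpleWeight w) A₀} : Finset (Finset V))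
    (cutWeight w) ⟨A₀, by simp⟩
  simp only [Finset.mem_filter, Finset.mem_univ, true_and] at hA hmin
  refine ⟨A, hA.1, (cutWeight_le_simple_add_three hcubic ?_).trans
    (Nat.add_le_add_right hA.2 3)⟩
  intro u hu v hv u' hu' v' hv' huv huv'
  by_contra hne
  have hv'₁ : v' ∉ A.erase u := fun h => hv' (Finset.mem_of_mem_erase h)
  have h₁ := cutWeight_erase_of_two_le hsymm hcubic hu hv huv
  have h₂ := cutWeight_insert_of_two_le hsymm hcubic
    (Finset.mem_erase.2 ⟨Ne.symm hne, hu'⟩) hv'₁ huv'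
  have hcard : (insert v' (A.erase u)).card = A.card := by
    rw [Finset.card_insert_of_notMem hv'₁, Finset.card_erase_add_one hu]
  have := hmin _ ⟨hcard.trans hA.1, by omega⟩
  omega

end Cut

/-- Bisection width of cubic multigraphs from the simple-graph case: let `w` be a symmetric
loopless edge-multiplicity function on a finite vertex set `V` of `n` vertices making the
multigraph cubic (every vertex has degree 3), let `ε > 0` with `n ≥ 6/ε`, and suppose there
is a bisection `(A', B')` of `V` whose size in the underlying simple graph (the number of
unordered pairs `{u, v}` with `u ∈ A'`, `v ∈ B'`, `w u v ≥ 1`) is at most `(1/6 + ε/2)·n`.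
Then there is a bisection `(A, B)` of `V` whose size in the multigraph (the total
multiplicity `Σ_{u ∈ A, v ∈ B} w u v`) is at most `(1/6 + ε)·n`. -/
theorem cubic_multigraph_bisection (V : Type*) [Fintype V] [DecidableEq V]
    (w : V → V → ℕ) (hsymm : ∀ u v, w u v = w v u) (hloop : ∀ v, w v v = 0)
    (hcubic : ∀ v, ∑ u : V, w v u = 3)
    (ε : ℝ) (hε : 0 < ε) (hn : 6 / ε ≤ (Fintype.card V : ℝ))
    (A' B' : Finset V) (hdisj' : Disjoint A' B') (hunion' : A' ∪ B' = Finset.univ)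
    (hbal' : |(A'.card : ℤ) - (B'.card : ℤ)| ≤ 1)
    (hcut' : (((A' ×ˢ B').filter (fun p => 1 ≤ w p.1 p.2)).card : ℝ) ≤
        (1 / 6 + ε / 2) * (Fintype.card V : ℝ)) :
    ∃ A B : Finset V, Disjoint A B ∧ A ∪ B = Finset.univ ∧
      |(A.card : ℤ) - (B.card : ℤ)| ≤ 1 ∧
      ((∑ p ∈ A ×ˢ B, w p.1 p.2 : ℕ) : ℝ) ≤ (1 / 6 + ε) * (Fintype.card V : ℝ) := by
  have hB' : B' = A'ᶜ := (IsCompl.of_eq (Finset.disjoint_iff_inter_eq_empty.1 hdisj')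
    hunion').symm.eq_compl
  subst hB'
  obtain ⟨A, hcard, hcut⟩ := exists_card_eq_cutWeight_le hsymm hcubic A'
  have hsimple : ((A' ×ˢ A'ᶜ).filter (fun p => 1 ≤ w p.1 p.2)).card =
      cutWeight (simpleWeight w) A' := by
    rw [Finset.card_filter, Finset.sum_product]
    rfl
  refine ⟨A, Aᶜ, disjoint_compl_right, Finset.union_compl A, ?_, ?_⟩
  · rwa [Finset.card_compl, hcard, ← Finset.card_compl]
  · have hsum : ∑ p ∈ A ×ˢ Aᶜ, w p.1 p.2 = cutWeight w A := Finset.sum_product ..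
    have hn' := (div_le_iff₀ hε).1 hn
    have hcutR : (cutWeight w A : ℝ) ≤ cutWeight (simpleWeight w) A' + 3 := by
      exact_mod_cast hcut
    rw [hsimple] at hcut'
    rw [hsum]
    linarith
end
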